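/- Let n ≥ 1, 0 ≤ δ < 1, a ∈ S^{-n}_{0,δ}, 0 < θ_1 < (n/2)(1−δ), ε > 0, and let N > n be a positive integer. There is a constant C (depending on these parameters and finitely many seminorms of a) such that for every l ≥ 1, every positive integer j, every x_0 ∈ ℝⁿ, and every Schwartz function u: |Q(x_0,l)|^{-1} ∫_{Q(x_0,l)} |T_j u(x)| dx ≤ C (2^{−j(n/2)(1−δ) + jθ_1 + jεn} + 2^{−jε(N−n)} l^{−(N−n)}) Mu(x_0). -/

import Mathlib

open MeasureTheory Real
open scoped ENNReal NNReal InnerProductSpace BigOperators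

noncomputable section

/-- `ℝⁿ` with its Euclidean structure. -/
abbrev Rn (n : ℕ) : Type := EuclideanSpace ℝ (Fin n)

/-- The Fourier transform `û(ξ) = ∫ e^{-i⟨x,ξ⟩} u(x) dx`. -/
def ft {n : ℕ} (u : Rn n → ℂ) (ξ : Rn n) : ℂ :=
  ∫ x : Rn n, Complex.exp (-(Complex.I * ((⟪x, ξ⟫_ℝ : ℝ) : ℂ))) * u x

/-- The pseudo-differential operator `T_a u(x) = ∫ e^{i⟨x,ξ⟩} a(x,ξ) û(ξ) dξ`. -/
def pdo {n : ℕ} (a : Rn n → Rn n → ℂ) (u : Rn n → ℂ) (x : Rn n) : ℂ :=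
  ∫ ξ : Rn n, Complex.exp (Complex.I * ((⟪x, ξ⟫_ℝ : ℝ) : ℂ)) * a x ξ * ft u ξ

/-- The dual operator `T_a^* u(x) = ∫∫ e^{i⟨x-y,ξ⟩} a(y,ξ) dξ u(y) dy`. -/
def pdoDual {n : ℕ} (a : Rn n → Rn n → ℂ) (u : Rn n → ℂ) (x : Rn n) : ℂ :=
  ∫ y : Rn n,
    (∫ ξ : Rn n, Complex.exp (Complex.I * ((⟪x - y, ξ⟫_ℝ : ℝ) : ℂ)) * a y ξ) * u y

/-- The Hörmander symbol class `S^m_{ϱ,δ}`: `a` is smooth and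
`|∂^β_x ∂^α_ξ a(x,ξ)| ≤ C_{α,β} (1+|ξ|²)^{(m-ϱ|α|+δ|β|)/2}`. -/
def HormClass {n : ℕ} (m ϱ δ : ℝ) (a : Rn n → Rn n → ℂ) : Prop :=
  ContDiff ℝ (⊤ : ℕ∞) (Function.uncurry a) ∧
  ∀ k l : ℕ, ∃ C : ℝ, 0 < C ∧ ∀ x ξ : Rn n,
    ‖iteratedFDeriv ℝ l (fun y : Rn n => iteratedFDeriv ℝ k (fun η : Rn n => a y η) ξ) x‖ ≤
      C * (1 + ‖ξ‖ ^ 2) ^ ((m - ϱ * k + δ * l) / 2)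

/-- The rough Hörmander class `L^∞S^m_ϱ`: `a(x,ξ)` is smooth in `ξ`, bounded measurable in `x`,
and `‖∂^α_ξ a(·,ξ)‖_{L^∞} ≤ C_α (1+|ξ|²)^{(m-ϱ|α|)/2}`. -/
def RoughClass {n : ℕ} (m ϱ : ℝ) (a : Rn n → Rn n → ℂ) : Prop :=
  (∀ x : Rn n, ContDiff ℝ (⊤ : ℕ∞) (a x)) ∧
  (∀ ξ : Rn n, Measurable fun x : Rn n => a x ξ) ∧
  ∀ k : ℕ, ∃ C : ℝ, 0 < C ∧ ∀ ξ : Rn n, ∀ᵐ x : Rn n ∂volume,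
    ‖iteratedFDeriv ℝ k (a x) ξ‖ ≤ C * (1 + ‖ξ‖ ^ 2) ^ ((m - ϱ * k) / 2)

/-- The axis-parallel cube centered at `x₀` with side length `l`. -/
def cube {n : ℕ} (x₀ : Rn n) (l : ℝ) : Set (Rn n) :=
  {y | ∀ i, |y i - x₀ i| ≤ l / 2}

/-- The Hardy–Littlewood maximal function over axis-parallel cubes. -/
def mHL {n : ℕ} {E : Type*} [NormedAddCommGroup E] (u : Rn n → E) (x : Rn n) : ℝ≥0∞ :=
  ⨆ (x₀ : Rn n) (l : ℝ) (_ : 0 < l) (_ : x ∈ cube x₀ l),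
    (∫⁻ y in cube x₀ l, (‖u y‖₊ : ℝ≥0∞)) / ENNReal.ofReal (l ^ n)

/-- The Fefferman–Stein sharp maximal function over axis-parallel cubes. -/
def mSharp {n : ℕ} (u : Rn n → ℂ) (x : Rn n) : ℝ≥0∞ :=
  ⨆ (x₀ : Rn n) (l : ℝ) (_ : 0 < l) (_ : x ∈ cube x₀ l),
    ⨅ c : ℂ, (∫⁻ y in cube x₀ l, (‖u y - c‖₊ : ℝ≥0∞)) / ENNReal.ofReal (l ^ n)

/-- The Muckenhoupt `A₁` condition: `Mω ≤ C ω` a.e. -/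
def IsA1 {n : ℕ} (ω : Rn n → ℝ) : Prop :=
  (∀ x, 0 ≤ ω x) ∧ LocallyIntegrable ω volume ∧
  ∃ C : ℝ, 0 < C ∧ ∀ᵐ x : Rn n ∂volume, mHL ω x ≤ ENNReal.ofReal (C * ω x)

/-- The Muckenhoupt `A_p` condition for `1 < p < ∞`. -/
def IsAp {n : ℕ} (p : ℝ) (ω : Rn n → ℝ) : Prop :=
  (∀ x, 0 ≤ ω x) ∧ LocallyIntegrable ω volume ∧
  ∃ C : ℝ, 0 < C ∧ ∀ (x₀ : Rn n) (l : ℝ), 0 < l →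
    ((∫⁻ y in cube x₀ l, ENNReal.ofReal (ω y)) / ENNReal.ofReal (l ^ n)) *
      (((∫⁻ y in cube x₀ l, ENNReal.ofReal (ω y ^ (1 / (1 - p)))) /
          ENNReal.ofReal (l ^ n)) ^ (p - 1))
      ≤ ENNReal.ofReal C

/-- The weighted measure `ω(s) = ∫_s ω dx`. -/
def wMeas {n : ℕ} (ω : Rn n → ℝ) (s : Set (Rn n)) : ℝ≥0∞ :=
  ∫⁻ x in s, ENNReal.ofReal (ω x)

/-- The weighted `L¹` norm `∫ |u| ω dx`. -/
def wL1 {n : ℕ} (ω : Rn n → ℝ) (u : Rn n → ℂ) : ℝ≥0∞ :=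
  ∫⁻ x : Rn n, (‖u x‖₊ : ℝ≥0∞) * ENNReal.ofReal (ω x)

/-- The weighted `L^p` norm `(∫ |u|^p ω dx)^{1/p}`. -/
def wLp {n : ℕ} (p : ℝ) (ω : Rn n → ℝ) (u : Rn n → ℂ) : ℝ≥0∞ :=
  (∫⁻ x : Rn n, (‖u x‖₊ : ℝ≥0∞) ^ p * ENNReal.ofReal (ω x)) ^ (1 / p)

/-- A Littlewood–Paley cut-off: `ψ ∈ C_c^∞`, `0 ≤ ψ ≤ 1`, supported in the annulus
`{C₀⁻¹ ≤ |ξ| ≤ 2C₀}`. -/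
def LPcut {n : ℕ} (C₀ : ℝ) (ψ : Rn n → ℝ) : Prop :=
  ContDiff ℝ (⊤ : ℕ∞) ψ ∧ HasCompactSupport ψ ∧ (∀ ξ, 0 ≤ ψ ξ) ∧ (∀ ξ, ψ ξ ≤ 1) ∧
  tsupport ψ ⊆ {ξ : Rn n | C₀⁻¹ ≤ ‖ξ‖ ∧ ‖ξ‖ ≤ 2 * C₀}

/-- `K_j(x,y) = (2π)^{-n} ∫ e^{i⟨x-y,ξ⟩} a(x,ξ) ψ(2^{-j}ξ) dξ`. -/
def Kj {n : ℕ} (a : Rn n → Rn n → ℂ) (ψ : Rn n → ℝ) (j : ℕ) (x y : Rn n) : ℂ :=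
  ((((2 * π) ^ n)⁻¹ : ℝ) : ℂ) *
    ∫ ξ : Rn n, Complex.exp (Complex.I * ((⟪x - y, ξ⟫_ℝ : ℝ) : ℂ)) * a x ξ *
      ((ψ ((((2 : ℝ) ^ j)⁻¹) • ξ) : ℝ) : ℂ)

/-- `K_j^*(x,y) = (2π)^{-n} ∫ e^{i⟨x-y,ξ⟩} a(y,ξ) ψ(2^{-j}ξ) dξ`. -/
def KjStar {n : ℕ} (a : Rn n → Rn n → ℂ) (ψ : Rn n → ℝ) (j : ℕ) (x y : Rn n) : ℂ :=
  ((((2 * π) ^ n)⁻¹ : ℝ) : ℂ) *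
    ∫ ξ : Rn n, Complex.exp (Complex.I * ((⟪x - y, ξ⟫_ℝ : ℝ) : ℂ)) * a y ξ *
      ((ψ ((((2 : ℝ) ^ j)⁻¹) • ξ) : ℝ) : ℂ)

/-- `T_j u(x) = ∫ K_j(x,y) u(y) dy`. -/
def Tj {n : ℕ} (a : Rn n → Rn n → ℂ) (ψ : Rn n → ℝ) (j : ℕ) (u : Rn n → ℂ) (x : Rn n) : ℂ :=
  ∫ y : Rn n, Kj a ψ j x y * u y

/-- `T_j^* u(x) = ∫ K_j^*(x,y) u(y) dy`. -/
def TjStar {n : ℕ} (a : Rn n → Rn n → ℂ) (ψ : Rn n → ℝ) (j : ℕ) (u : Rn n → ℂ) (x : Rn n) : ℂ :=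
  ∫ y : Rn n, KjStar a ψ j x y * u y

/-- The Fourier integral operator `T_{a,φ} u(x) = ∫ e^{iφ(x,ξ)} a(x,ξ) û(ξ) dξ`. -/
def fio {n : ℕ} (a : Rn n → Rn n → ℂ) (φ : Rn n → Rn n → ℝ) (u : Rn n → ℂ) (x : Rn n) : ℂ :=
  ∫ ξ : Rn n, Complex.exp (Complex.I * ((φ x ξ : ℝ) : ℂ)) * a x ξ * ft u ξ

/-- The dual FIO `T^*_{a,φ} u(x) = ∫∫ e^{i(φ(y,ξ)-⟨x,ξ⟩)} a(y,ξ) dξ u(y) dy`. -/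
def fioDual {n : ℕ} (a : Rn n → Rn n → ℂ) (φ : Rn n → Rn n → ℝ) (u : Rn n → ℂ) (x : Rn n) : ℂ :=
  ∫ y : Rn n,
    (∫ ξ : Rn n, Complex.exp (Complex.I * ((φ y ξ - ⟪x, ξ⟫_ℝ : ℝ) : ℂ)) * a y ξ) * u y

/-- The phase class `Φ¹`: smooth on `ℝⁿ × (ℝⁿ∖{0})`, positively homogeneous of degree 1 in `ξ`,
with `sup |ξ|^{-1+|α|} |∂^α_ξ ∂^β_x φ| ≤ C_{α,β}` for `|α|+|β| ≥ 1`. -/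
def Phi1 {n : ℕ} (φ : Rn n → Rn n → ℝ) : Prop :=
  ContDiffOn ℝ (⊤ : ℕ∞) (Function.uncurry φ) {p : Rn n × Rn n | p.2 ≠ 0} ∧
  (∀ x : Rn n, ∀ ξ : Rn n, ξ ≠ 0 → ∀ t : ℝ, 0 < t → φ x (t • ξ) = t * φ x ξ) ∧
  ∀ k l : ℕ, 1 ≤ k + l → ∃ C : ℝ, 0 < C ∧ ∀ x ξ : Rn n, ξ ≠ 0 →
    ‖ξ‖ ^ ((k : ℝ) - 1) *
        ‖iteratedFDeriv ℝ k (fun η : Rn n => iteratedFDeriv ℝ l (fun y : Rn n => φ y η) x) ξ‖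
      ≤ C

/-- The rough phase class `L^∞Φ¹`: positively homogeneous of degree 1 in `ξ`, smooth in `ξ` away
from the origin, bounded measurable in `x`, with `sup |ξ|^{-1+|α|} ‖∂^α_ξ φ(·,ξ)‖_{L^∞} ≤ C_α`
for `|α| ≥ 1`. -/
def LinfPhi1 {n : ℕ} (φ : Rn n → Rn n → ℝ) : Prop :=
  (∀ x : Rn n, ContDiffOn ℝ (⊤ : ℕ∞) (φ x) {ξ : Rn n | ξ ≠ 0}) ∧
  (∀ ξ : Rn n, Measurable fun x : Rn n => φ x ξ) ∧
  (∀ ξ : Rn n, ∃ C : ℝ, ∀ x : Rn n, |φ x ξ| ≤ C) ∧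
  (∀ x : Rn n, ∀ ξ : Rn n, ξ ≠ 0 → ∀ t : ℝ, 0 < t → φ x (t • ξ) = t * φ x ξ) ∧
  ∀ k : ℕ, 1 ≤ k → ∃ C : ℝ, 0 < C ∧ ∀ ξ : Rn n, ξ ≠ 0 → ∀ᵐ x : Rn n ∂volume,
    ‖ξ‖ ^ ((k : ℝ) - 1) * ‖iteratedFDeriv ℝ k (φ x) ξ‖ ≤ C

/-- Leibniz rule in the form of a pointwise bound: if the derivatives of order `m ≤ M` of two
functions are bounded by `A s ^ m` and `B s ^ m` at a point, those of the product are bounded by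
`2 ^ M A B s ^ m`. -/
theorem norm_iteratedFDeriv_mul_le_two_pow {E : Type*} [NormedAddCommGroup E] [NormedSpace ℝ E]
    {f g : E → ℂ} (hf : ContDiff ℝ (⊤ : ℕ∞) f) (hg : ContDiff ℝ (⊤ : ℕ∞) g) {x : E} {M : ℕ}
    {A B s : ℝ} (hs : 0 ≤ s) (hA : ∀ m ≤ M, ‖iteratedFDeriv ℝ m f x‖ ≤ A * s ^ m)
    (hB : ∀ m ≤ M, ‖iteratedFDeriv ℝ m g x‖ ≤ B * s ^ m) {m : ℕ} (hm : m ≤ M) :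
    ‖iteratedFDeriv ℝ m (fun y => f y * g y) x‖ ≤ 2 ^ M * (A * B) * s ^ m := by
  have hA0 : 0 ≤ A := by simpa using (norm_nonneg _).trans (hA 0 (Nat.zero_le _))
  have hB0 : 0 ≤ B := by simpa using (norm_nonneg _).trans (hB 0 (Nat.zero_le _))
  calc ‖iteratedFDeriv ℝ m (fun y => f y * g y) x‖
      ≤ ∑ i ∈ Finset.range (m + 1),
          (m.choose i : ℝ) * ‖iteratedFDeriv ℝ i f x‖ * ‖iteratedFDeriv ℝ (m - i) g x‖ :=
        norm_iteratedFDeriv_mul_le hf hg x (by exact_mod_cast le_top)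
    _ ≤ ∑ i ∈ Finset.range (m + 1), (m.choose i : ℝ) * (A * B * s ^ m) := by
        refine Finset.sum_le_sum fun i hi => ?_
        rw [Finset.mem_range] at hi
        have e : A * B * s ^ m = (A * s ^ i) * (B * s ^ (m - i)) := by
          rw [← pow_mul_pow_sub s (by omega : i ≤ m)]
          ring
        rw [mul_assoc, e]
        gcongr
        · exact hA i (by omega)
        · exact hB _ (by omega)
    _ = 2 ^ m * (A * B * s ^ m) := by
        rw [← Finset.sum_mul]
        congr 1
        exact_mod_cast Nat.sum_range_choose m
    _ ≤ 2 ^ M * (A * B * s ^ m) := by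
        gcongr
        norm_num
    _ = _ := by ring

/-- Non-stationary phase: the oscillatory integral of a smooth function supported in a ball of
radius `ρ` with all derivatives of order at most `M` bounded by `B` is
`O(‖w‖ ^ (-M) B ρ ^ n)`. -/
theorem exists_norm_pow_mul_oscillatory_le (n M : ℕ) :
    ∃ C : ℝ, 0 < C ∧ ∀ (f : Rn n → ℂ) (c : Rn n) (ρ B : ℝ), 0 < ρ → ContDiff ℝ (⊤ : ℕ∞) f →
      Function.support f ⊆ Metric.closedBall c ρ →
      (∀ m ≤ M, ∀ x, ‖iteratedFDeriv ℝ m f x‖ ≤ B) → ∀ w : Rn n,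
      ‖w‖ ^ M * ‖∫ x, Complex.exp (Complex.I * ((⟪w, x⟫_ℝ : ℝ) : ℂ)) * f x‖ ≤
        C * (B * ρ ^ n) := by
  set V : ℝ := volume.real (Metric.closedBall (0 : Rn n) 1) with hV
  refine ⟨(2 * π) ^ M * (2 ^ M * ((M + 1) * V)) + 1, by positivity, ?_⟩
  intro f c ρ B hρ hf hsupp hB w
  have hB0 : 0 ≤ B := (norm_nonneg _).trans (hB 0 (Nat.zero_le _) 0)
  have hts : tsupport f ⊆ Metric.closedBall c ρ :=
    closure_minimal hsupp Metric.isClosed_closedBall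
  have hcs : HasCompactSupport f :=
    HasCompactSupport.of_support_subset_isCompact (isCompact_closedBall c ρ) hsupp
  have hvol : volume.real (Metric.closedBall c ρ) = ρ ^ n * V := by
    rw [hV, measureReal_def, measureReal_def, Measure.addHaar_closedBall' _ _ hρ.le,
      ENNReal.toReal_mul, ENNReal.toReal_ofReal (by positivity), finrank_euclideanSpace,
      Fintype.card_fin]
  have hfint : ∀ m : ℕ, Integrable (fun v => ‖iteratedFDeriv ℝ m f v‖) := fun m =>
    ((hf.continuous_iteratedFDeriv (by exact_mod_cast le_top)).norm).integrable_of_hasCompactSupport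
      (hcs.iteratedFDeriv m).norm
  have hbd : ∀ m ≤ M, ∫ v, ‖iteratedFDeriv ℝ m f v‖ ≤ B * (ρ ^ n * V) := by
    intro m hm
    have h0 : ∀ v, v ∉ Metric.closedBall c ρ → ‖iteratedFDeriv ℝ m f v‖ = 0 := by
      intro v hv
      rw [norm_eq_zero]
      by_contra h
      exact hv (hts (support_iteratedFDeriv_subset m h))
    rw [← setIntegral_eq_integral_of_forall_compl_eq_zero h0, ← hvol]
    have := norm_setIntegral_le_of_norm_le_const (μ := volume) (s := Metric.closedBall c ρ)
      (f := fun v => ‖iteratedFDeriv ℝ m f v‖) (C := B) measure_closedBall_lt_top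
      (fun v _ => by rw [norm_norm]; exact hB m hm v)
    exact (le_abs_self _).trans this
  set w' : Rn n := (-(2 * π)⁻¹ : ℝ) • w with hw'
  have hF : FourierTransform.fourier f w' =
      ∫ x, Complex.exp (Complex.I * ((⟪w, x⟫_ℝ : ℝ) : ℂ)) * f x := by
    rw [Real.fourier_eq']
    congr 1
    ext v
    rw [smul_eq_mul, hw', inner_smul_right, real_inner_comm]
    congr 2
    have : -2 * π * (-(2 * π)⁻¹ * ⟪w, v⟫_ℝ) = ⟪w, v⟫_ℝ := by
      field_simp
    rw [this, mul_comm]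
  have key := Real.pow_mul_norm_iteratedFDeriv_fourier_le (K := 0) (N := ⊤) (k := 0) (n := M)
    hf (fun k m hk _ => by
      have : k = 0 := by simpa using hk
      subst this
      simpa using hfint m) (by simp) (by simp) w'
  rw [norm_iteratedFDeriv_zero, hF] at key
  have hnorm : ‖w‖ ^ M = (2 * π) ^ M * ‖w'‖ ^ M := by
    rw [hw', norm_smul, norm_neg, norm_inv, Real.norm_of_nonneg (by positivity : (0:ℝ) ≤ 2 * π),
      ← mul_pow]
    field_simp
  have hsum : ∑ p ∈ Finset.range (0 + 1) ×ˢ Finset.range (M + 1),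
      ∫ v, ‖v‖ ^ p.1 * ‖iteratedFDeriv ℝ p.2 f v‖ ≤ (M + 1) * (B * (ρ ^ n * V)) := by
    calc _ ≤ ∑ p ∈ Finset.range (0 + 1) ×ˢ Finset.range (M + 1), B * (ρ ^ n * V) := by
          refine Finset.sum_le_sum fun p hp => ?_
          simp only [Finset.mem_product, Finset.mem_range] at hp
          have h1 : p.1 = 0 := by omega
          simpa [h1] using hbd p.2 (by omega)
      _ = _ := by simp
  have hV0 : 0 ≤ V := measureReal_nonneg
  calc _ = (2 * π) ^ M * (‖w'‖ ^ M *
        ‖∫ x, Complex.exp (Complex.I * ((⟪w, x⟫_ℝ : ℝ) : ℂ)) * f x‖) := by rw [hnorm, mul_assoc]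
    _ ≤ (2 * π) ^ M * (2 ^ M * ((M + 1) * (B * (ρ ^ n * V)))) := by
        refine mul_le_mul_of_nonneg_left (key.trans ?_) (by positivity)
        simp only [pow_zero, one_mul, Nat.cast_zero, mul_zero, zero_add]
        exact mul_le_mul_of_nonneg_left hsum (by positivity)
    _ = (2 * π) ^ M * (2 ^ M * ((M + 1) * V)) * (B * ρ ^ n) := by ring
    _ ≤ _ := by
        refine mul_le_mul_of_nonneg_right (by linarith) (by positivity)

/-- Finitely many bounds depending on an order of differentiation can be replaced by one. -/
theorem exists_uniform_bound {ι : Type*} {F : ℕ → ι → ℝ} {G : ι → ℝ} (hG : ∀ i, 0 ≤ G i)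
    (h : ∀ m, ∃ C : ℝ, 0 < C ∧ ∀ i, F m i ≤ C * G i) (M : ℕ) :
    ∃ C : ℝ, 0 < C ∧ ∀ m ≤ M, ∀ i, F m i ≤ C * G i := by
  choose C hC0 hC using h
  refine ⟨∑ m ∈ Finset.range (M + 1), C m,
    Finset.sum_pos (fun m _ => hC0 m) ⟨0, by simp⟩, fun m hm i => (hC m i).trans ?_⟩
  exact mul_le_mul_of_nonneg_right (Finset.single_le_sum (f := C) (fun k _ => (hC0 k).le)
    (Finset.mem_range.2 (by omega))) (hG i)

/-- The derivatives of a test function are bounded, uniformly over its translates and its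
dilates by factors at most one. -/
theorem exists_norm_iteratedFDeriv_dilate_le {E : Type*} [NormedAddCommGroup E] [NormedSpace ℝ E]
    {g : E → ℂ} (hg : ContDiff ℝ (⊤ : ℕ∞) g)
    (hc : HasCompactSupport g) (M : ℕ) :
    ∃ C : ℝ, 0 < C ∧ ∀ m ≤ M, ∀ (s : ℝ) (b x : E), |s| ≤ 1 →
      ‖iteratedFDeriv ℝ m (fun x => g (s • (x - b))) x‖ ≤ C := by
  have h1 : ∀ m, ∃ C : ℝ, 0 < C ∧ ∀ x : E, ‖iteratedFDeriv ℝ m g x‖ ≤ C * 1 := by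
    intro m
    obtain ⟨C, hC⟩ := (hc.iteratedFDeriv (𝕜 := ℝ) m).exists_bound_of_continuous
      (hg.continuous_iteratedFDeriv (by exact_mod_cast le_top))
    refine ⟨max C 1, by positivity, fun x => ?_⟩
    rw [mul_one]
    exact (hC x).trans (le_max_left _ _)
  obtain ⟨C, hC0, hC⟩ := exists_uniform_bound (fun _ => zero_le_one) h1 M
  refine ⟨C, hC0, fun m hm s b x hs => ?_⟩
  have h2 := iteratedFDeriv_comp_sub (𝕜 := ℝ) (f := fun z => g (s • z)) m b x
  have h3 := iteratedFDeriv_comp_const_smul (𝕜 := ℝ) (f := g) (i := m) s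
    (hg.of_le (by exact_mod_cast le_top))
  rw [h2, h3, norm_smul, norm_pow, Real.norm_eq_abs]
  calc |s| ^ m * ‖iteratedFDeriv ℝ m g (s • (x - b))‖
      ≤ 1 * (C * 1) := by
        gcongr
        · exact pow_le_one₀ (abs_nonneg _) hs
        · exact hC m hm _
    _ = C := by ring

/-- On a dyadic annulus of size `2 ^ j` the weight `(1 + ‖ξ‖²) ^ (s / 2)` is `O(2 ^ (j s))`. -/
theorem exists_one_add_sq_rpow_le (n : ℕ) (s : ℝ) {C₀ : ℝ} (hC₀ : 1 < C₀) :
    ∃ C : ℝ, 0 < C ∧ ∀ (j : ℕ) (ξ : Rn n), C₀⁻¹ ≤ ‖((2 : ℝ) ^ j)⁻¹ • ξ‖ →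
      ‖((2 : ℝ) ^ j)⁻¹ • ξ‖ ≤ 2 * C₀ →
      (1 + ‖ξ‖ ^ 2) ^ (s / 2) ≤ C * ((2 : ℝ) ^ j) ^ s := by
  have hC₀' : 0 < C₀ := by linarith
  refine ⟨(1 + (2 * C₀) ^ 2) ^ (s / 2) + ((C₀⁻¹) ^ 2) ^ (s / 2), by positivity, ?_⟩
  intro j ξ h1 h2
  have hR : (1 : ℝ) ≤ 2 ^ j := one_le_pow₀ (by norm_num)
  set R : ℝ := 2 ^ j
  have hR0 : 0 < R := by linarith
  have hRs : (R ^ 2) ^ (s / 2) = R ^ s := by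
    rw [← Real.rpow_natCast R 2, ← Real.rpow_mul hR0.le]
    congr 1
    push_cast
    ring
  have hξ : ‖ξ‖ = R * ‖R⁻¹ • ξ‖ := by
    rw [norm_smul, norm_inv, Real.norm_of_nonneg hR0.le, mul_inv_cancel_left₀ hR0.ne']
  set t := ‖R⁻¹ • ξ‖
  rw [add_mul, hξ]
  rcases le_total 0 s with hs | hs
  · calc (1 + (R * t) ^ 2) ^ (s / 2) ≤ ((1 + (2 * C₀) ^ 2) * R ^ 2) ^ (s / 2) := by
          refine Real.rpow_le_rpow (by positivity) ?_ (by positivity)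
          have : (R * t) ^ 2 ≤ (2 * C₀) ^ 2 * R ^ 2 := by
            rw [← mul_pow, mul_comm]
            gcongr
          nlinarith
      _ = (1 + (2 * C₀) ^ 2) ^ (s / 2) * R ^ s := by
          rw [Real.mul_rpow (by positivity) (by positivity), hRs]
      _ ≤ _ := le_add_of_nonneg_right (by positivity)
  · calc (1 + (R * t) ^ 2) ^ (s / 2) ≤ ((C₀⁻¹) ^ 2 * R ^ 2) ^ (s / 2) := by
          refine Real.rpow_le_rpow_of_nonpos (by positivity) ?_ (by linarith)
          have : (C₀⁻¹) ^ 2 * R ^ 2 ≤ (R * t) ^ 2 := by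
            rw [← mul_pow, mul_comm]
            gcongr
          linarith
      _ = ((C₀⁻¹) ^ 2) ^ (s / 2) * R ^ s := by
          rw [Real.mul_rpow (by positivity) (by positivity), hRs]
      _ ≤ _ := le_add_of_nonneg_left (by positivity)

section Symbol

variable {n : ℕ} {m δ C₀ : ℝ} {a : Rn n → Rn n → ℂ} {ψ : Rn n → ℝ}

theorem HormClass.contDiff_right {ϱ : ℝ} (ha : HormClass m ϱ δ a) (x : Rn n) :
    ContDiff ℝ (⊤ : ℕ∞) (a x) :=
  ha.1.comp (contDiff_prodMk_right x)

theorem HormClass.contDiff_left {ϱ : ℝ} (ha : HormClass m ϱ δ a) (ξ : Rn n) :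
    ContDiff ℝ (⊤ : ℕ∞) (fun x => a x ξ) :=
  ha.1.comp (contDiff_prodMk_left ξ)

theorem LPcut.contDiff_ofReal_comp (hψ : LPcut C₀ ψ) :
    ContDiff ℝ (⊤ : ℕ∞) (fun ξ => (ψ ξ : ℂ)) :=
  Complex.ofRealCLM.contDiff.comp hψ.1

theorem LPcut.mem_annulus (hψ : LPcut C₀ ψ) {ξ : Rn n} (h : ψ ξ ≠ 0) :
    C₀⁻¹ ≤ ‖ξ‖ ∧ ‖ξ‖ ≤ 2 * C₀ :=
  hψ.2.2.2.2 (subset_tsupport _ h)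

theorem LPcut.norm_le_of_dilate_ne_zero (hψ : LPcut C₀ ψ) {j : ℕ} {ξ : Rn n}
    (h : ψ (((2 : ℝ) ^ j)⁻¹ • ξ) ≠ 0) : ‖ξ‖ ≤ 2 * C₀ * 2 ^ j := by
  have := (hψ.mem_annulus h).2
  rwa [norm_smul, norm_inv, norm_pow, Real.norm_two, inv_mul_le_iff₀ (by positivity),
    mul_comm] at this

/-- The dyadic pieces of a symbol of order `m` and type `ϱ = 0`, together with their
`ξ`-derivatives, are `O(2 ^ (j m))`. -/
theorem HormClass.exists_norm_iteratedFDeriv_dyadic_le (ha : HormClass m 0 δ a) (hC₀ : 1 < C₀)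
    (hψ : LPcut C₀ ψ) (M : ℕ) :
    ∃ C : ℝ, 0 < C ∧ ∀ k ≤ M, ∀ (j : ℕ) (x ξ : Rn n),
      ‖iteratedFDeriv ℝ k (fun η => a x η * (ψ (((2 : ℝ) ^ j)⁻¹ • η) : ℂ)) ξ‖ ≤
        C * ((2 : ℝ) ^ j) ^ m := by
  have h1 : ∀ k, ∃ C : ℝ, 0 < C ∧ ∀ p : Rn n × Rn n,
      ‖iteratedFDeriv ℝ k (a p.1) p.2‖ ≤ C * (1 + ‖p.2‖ ^ 2) ^ (m / 2) := by
    intro k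
    obtain ⟨C, hC0, hC⟩ := ha.2 k 0
    refine ⟨C, hC0, fun p => ?_⟩
    have := hC p.1 p.2
    rw [norm_iteratedFDeriv_zero] at this
    simpa using this
  obtain ⟨A, hA0, hA⟩ := exists_uniform_bound (fun p => by positivity) h1 M
  obtain ⟨B, hB0, hB⟩ := exists_norm_iteratedFDeriv_dilate_le hψ.contDiff_ofReal_comp
    (hψ.2.1.comp_left Complex.ofReal_zero) M
  obtain ⟨D, hD0, hD⟩ := exists_one_add_sq_rpow_le n m hC₀
  refine ⟨2 ^ M * (A * D * B), by positivity, fun k hk j x ξ => ?_⟩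
  have hR : (1 : ℝ) ≤ 2 ^ j := one_le_pow₀ (by norm_num)
  have hsm : ContDiff ℝ (⊤ : ℕ∞) (fun η : Rn n => (ψ (((2 : ℝ) ^ j)⁻¹ • η) : ℂ)) :=
    hψ.contDiff_ofReal_comp.comp (contDiff_const_smul _)
  by_cases hξ : C₀⁻¹ ≤ ‖((2 : ℝ) ^ j)⁻¹ • ξ‖ ∧ ‖((2 : ℝ) ^ j)⁻¹ • ξ‖ ≤ 2 * C₀
  · calc _ ≤ 2 ^ M * ((A * (D * ((2 : ℝ) ^ j) ^ m)) * B) * 1 ^ k := by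
          refine norm_iteratedFDeriv_mul_le_two_pow (ha.contDiff_right x) hsm zero_le_one (fun i hi => ?_)
            (fun i hi => ?_) hk
          · rw [one_pow, mul_one]
            refine (hA i hi (x, ξ)).trans ?_
            gcongr
            exact hD j ξ hξ.1 hξ.2
          · have := hB i hi ((2 : ℝ) ^ j)⁻¹ 0 ξ (by
              rw [abs_of_nonneg (by positivity)]
              exact inv_le_one_of_one_le₀ hR)
            simpa using this
      _ = _ := by rw [one_pow]; ring
  · have hcl : IsClosed {η : Rn n | C₀⁻¹ ≤ ‖((2 : ℝ) ^ j)⁻¹ • η‖ ∧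
        ‖((2 : ℝ) ^ j)⁻¹ • η‖ ≤ 2 * C₀} := by
      rw [Set.ofPred_and]
      exact (isClosed_le (by fun_prop) (by fun_prop)).inter
        (isClosed_le (by fun_prop) (by fun_prop))
    have hz : iteratedFDeriv ℝ k (fun η => a x η * (ψ (((2 : ℝ) ^ j)⁻¹ • η) : ℂ)) ξ = 0 := by
      by_contra h
      refine hξ (closure_minimal (fun η hη => ?_) hcl (support_iteratedFDeriv_subset k h))
      refine hψ.mem_annulus fun h0 => hη ?_
      simp [h0]
    rw [hz, norm_zero]
    positivity

/-- On dyadic annuli of size `2 ^ j`, the `x`-derivatives of order at most `M` of a symbol in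
`S^m_{0,δ}` are `O(2 ^ (j m) 2 ^ (j δ M))`. -/
theorem HormClass.exists_norm_iteratedFDeriv_left_le (ha : HormClass m 0 δ a)
    (hC₀ : 1 < C₀) (M : ℕ) :
    ∃ C : ℝ, 0 < C ∧ ∀ k ≤ M, ∀ (j : ℕ) (x ξ : Rn n), C₀⁻¹ ≤ ‖((2 : ℝ) ^ j)⁻¹ • ξ‖ →
      ‖((2 : ℝ) ^ j)⁻¹ • ξ‖ ≤ 2 * C₀ →
      ‖iteratedFDeriv ℝ k (fun y => a y ξ) x‖ ≤
        C * (((2 : ℝ) ^ j) ^ m * (((2 : ℝ) ^ j) ^ δ) ^ k) := by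
  choose A hA0 hA using ha.2 0
  choose D hD0 hD using fun k : ℕ => exists_one_add_sq_rpow_le n (m + δ * k) hC₀
  refine ⟨∑ k ∈ Finset.range (M + 1), A k * D k,
    Finset.sum_pos (fun k _ => mul_pos (hA0 k) (hD0 k)) ⟨0, by simp⟩, ?_⟩
  intro k hk j x ξ h1 h2
  have hR : (0 : ℝ) < 2 ^ j := by positivity
  have e : (fun y => iteratedFDeriv ℝ 0 (fun η => a y η) ξ) =
      (continuousMultilinearCurryFin0 ℝ (Rn n) ℂ).symm ∘ (fun y => a y ξ) := by
    ext y
    simp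
  have h3 := hA k x ξ
  rw [e, LinearIsometryEquiv.norm_iteratedFDeriv_comp_left] at h3
  have h4 := hD k j ξ h1 h2
  calc _ ≤ A k * (1 + ‖ξ‖ ^ 2) ^ ((m + δ * k) / 2) := by simpa using h3
    _ ≤ A k * (D k * ((2 : ℝ) ^ j) ^ (m + δ * k)) := by
        have := hA0 k
        gcongr
    _ = (A k * D k) * (((2 : ℝ) ^ j) ^ m * (((2 : ℝ) ^ j) ^ δ) ^ k) := by
        rw [Real.rpow_add hR, Real.rpow_mul_natCast hR.le]
        ring
    _ ≤ _ := by
        refine mul_le_mul_of_nonneg_right ?_ (by positivity)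
        exact Finset.single_le_sum (f := fun k => A k * D k)
          (fun i _ => (mul_pos (hA0 i) (hD0 i)).le) (Finset.mem_range.2 (by omega))

end Symbol

section Kernel

variable {n : ℕ} {m δ C₀ : ℝ} {a : Rn n → Rn n → ℂ} {ψ : Rn n → ℝ}

theorem norm_inv_two_pi_pow_le_one (n : ℕ) : ‖((((2 * π) ^ n)⁻¹ : ℝ) : ℂ)‖ ≤ 1 := by
  rw [Complex.norm_real, Real.norm_of_nonneg (by positivity)]
  exact inv_le_one_of_one_le₀ (one_le_pow₀ (by nlinarith [Real.pi_gt_three]))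

/-- Off-diagonal decay of the dyadic kernels of a symbol of order `-n` and type `ϱ = 0`. -/
theorem exists_norm_pow_mul_Kj_le (ha : HormClass (-(n : ℝ)) 0 δ a) (hC₀ : 1 < C₀)
    (hψ : LPcut C₀ ψ) (L : ℕ) :
    ∃ C : ℝ, 0 < C ∧ ∀ (j : ℕ) (x y : Rn n), ‖x - y‖ ^ L * ‖Kj a ψ j x y‖ ≤ C := by
  obtain ⟨A, hA0, hA⟩ := ha.exists_norm_iteratedFDeriv_dyadic_le hC₀ hψ L
  obtain ⟨D, hD0, hD⟩ := exists_norm_pow_mul_oscillatory_le n L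
  refine ⟨D * (A * (2 * C₀) ^ n), by positivity, fun j x y => ?_⟩
  have hR : (0 : ℝ) < 2 ^ j := by positivity
  have h := hD (fun η => a x η * (ψ (((2 : ℝ) ^ j)⁻¹ • η) : ℂ)) 0 (2 * C₀ * 2 ^ j)
    (A * ((2 : ℝ) ^ j) ^ (-(n : ℝ))) (by positivity)
    ((ha.contDiff_right x).mul (hψ.contDiff_ofReal_comp.comp (contDiff_const_smul _)))
    (fun η hη => by
      rw [mem_closedBall_zero_iff]
      exact hψ.norm_le_of_dilate_ne_zero fun h0 => hη (by simp [h0]))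
    (fun k hk η => hA k hk j x η) (x - y)
  simp_rw [← mul_assoc] at h
  rw [Kj, norm_mul]
  calc _ ≤ ‖x - y‖ ^ L * (1 * ‖∫ ξ : Rn n, Complex.exp (Complex.I * ((⟪x - y, ξ⟫_ℝ : ℝ) : ℂ)) *
        a x ξ * ((ψ ((((2 : ℝ) ^ j)⁻¹) • ξ) : ℝ) : ℂ)‖) := by
        gcongr
        exact norm_inv_two_pi_pow_le_one n
    _ ≤ _ := by
        rw [one_mul]
        refine h.trans_eq ?_
        rw [Real.rpow_neg hR.le, Real.rpow_natCast, mul_pow]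
        field_simp

theorem continuous_kernel_integrand (ha : Continuous (Function.uncurry a)) (hψ : Continuous ψ)
    (j : ℕ) :
    Continuous fun p : (Rn n × Rn n) × Rn n =>
      Complex.exp (Complex.I * ((⟪p.1.1 - p.1.2, p.2⟫_ℝ : ℝ) : ℂ)) * a p.1.1 p.2 *
        ((ψ ((((2 : ℝ) ^ j)⁻¹) • p.2) : ℝ) : ℂ) := by
  have h : Continuous fun p : (Rn n × Rn n) × Rn n => a p.1.1 p.2 :=
    ha.comp (f := fun p : (Rn n × Rn n) × Rn n => (p.1.1, p.2)) (by fun_prop)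
  fun_prop

theorem measurable_Kj (ha : Continuous (Function.uncurry a)) (hψ : Continuous ψ) (j : ℕ) :
    Measurable fun p : Rn n × Rn n => Kj a ψ j p.1 p.2 := by
  refine Measurable.const_mul ?_ _
  exact (MeasureTheory.StronglyMeasurable.integral_prod_right'
    (continuous_kernel_integrand ha hψ j).stronglyMeasurable).measurable

/-- The integral of `(1 + ‖ξ - η‖ / s) ^ (-(n + 1))` over `η` is `O(s ^ n)`. -/
theorem exists_lintegral_one_add_norm_sub_le (n : ℕ) :
    ∃ C : ℝ, 0 < C ∧ ∀ (s : ℝ) (ξ : Rn n), 0 < s →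
      ∫⁻ η : Rn n, ENNReal.ofReal (((1 + s⁻¹ * ‖ξ - η‖) ^ (n + 1))⁻¹) ≤
        ENNReal.ofReal (C * s ^ n) := by
  have hfint : Integrable (fun η : Rn n => ((1 + ‖η‖) ^ (n + 1))⁻¹) := by
    have h := integrable_one_add_norm (E := Rn n) (μ := volume) (r := n + 1) (by simp)
    refine h.congr (Filter.Eventually.of_forall fun η => ?_)
    have : (0 : ℝ) ≤ 1 + ‖η‖ := by positivity
    simp only
    rw [Real.rpow_neg this, ← Real.rpow_natCast]
    push_cast
    rfl
  refine ⟨(∫ η : Rn n, ((1 + ‖η‖) ^ (n + 1))⁻¹) + 1,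
    add_pos_of_nonneg_of_pos (integral_nonneg fun η => by positivity) one_pos, ?_⟩
  intro s ξ hs
  rw [lintegral_sub_left_eq_self (fun η : Rn n =>
    ENNReal.ofReal (((1 + s⁻¹ * ‖η‖) ^ (n + 1))⁻¹)) ξ]
  have e : ∀ η : Rn n, ((1 + s⁻¹ * ‖η‖) ^ (n + 1))⁻¹ = ((1 + ‖s⁻¹ • η‖) ^ (n + 1))⁻¹ := by
    intro η
    rw [norm_smul, norm_inv, Real.norm_of_nonneg hs.le]
  simp_rw [e]
  rw [← ofReal_integral_eq_lintegral_ofReal (hfint.comp_smul (inv_ne_zero hs.ne'))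
    (Filter.Eventually.of_forall fun η => by positivity),
    Measure.integral_comp_inv_smul volume (fun η : Rn n => ((1 + ‖η‖) ^ (n + 1))⁻¹),
    finrank_euclideanSpace, Fintype.card_fin, abs_of_nonneg (by positivity), smul_eq_mul]
  apply ENNReal.ofReal_le_ofReal
  rw [mul_comm]
  gcongr
  linarith

/-- Near-diagonal decay of the localized correlations `∫ χ a(x,ξ) conj (a(x,η)) e^{i⟨ξ-η,x⟩} dx`
of a symbol in `S^m_{0,δ}`. -/
theorem exists_correlation_le (ha : HormClass m 0 δ a) (hδ : 0 ≤ δ) (hC₀ : 1 < C₀)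
    {φ : Rn n → ℂ} (hφ : ContDiff ℝ (⊤ : ℕ∞) φ)
    (hφs : Function.support φ ⊆ Metric.closedBall 0 2) :
    ∃ C : ℝ, 0 < C ∧ ∀ (j : ℕ) (ρ : ℝ) (y ξ η : Rn n), 1 ≤ ρ →
      C₀⁻¹ ≤ ‖((2 : ℝ) ^ j)⁻¹ • ξ‖ → ‖((2 : ℝ) ^ j)⁻¹ • ξ‖ ≤ 2 * C₀ →
      C₀⁻¹ ≤ ‖((2 : ℝ) ^ j)⁻¹ • η‖ → ‖((2 : ℝ) ^ j)⁻¹ • η‖ ≤ 2 * C₀ →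
      ‖∫ x, Complex.exp (Complex.I * ((⟪ξ - η, x⟫_ℝ : ℝ) : ℂ)) *
        (φ (ρ⁻¹ • (x - y)) * (a x ξ * (starRingEnd ℂ) (a x η)))‖ ≤
      C * (ρ ^ n * (((2 : ℝ) ^ j) ^ m) ^ 2) *
        ((1 + (((2 : ℝ) ^ j) ^ δ)⁻¹ * ‖ξ - η‖) ^ (n + 1))⁻¹ := by
  have hcs : HasCompactSupport φ :=
    HasCompactSupport.of_support_subset_isCompact (isCompact_closedBall 0 2) hφs
  obtain ⟨B, hB0, hB⟩ := exists_norm_iteratedFDeriv_dilate_le hφ hcs (n + 1)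
  obtain ⟨A, hA0, hA⟩ := ha.exists_norm_iteratedFDeriv_left_le hC₀ (n + 1)
  obtain ⟨D₀, hD₀, hD₀'⟩ := exists_norm_pow_mul_oscillatory_le n 0
  obtain ⟨D₁, hD₁, hD₁'⟩ := exists_norm_pow_mul_oscillatory_le n (n + 1)
  set P : ℝ := 2 ^ (n + 1) * (B * (2 ^ (n + 1) * (A * A))) with hP
  refine ⟨2 ^ n * ((D₀ + D₁) * (P * 2 ^ n)), by positivity, ?_⟩
  intro j ρ y ξ η hρ h1 h2 h3 h4
  have hR : (1 : ℝ) ≤ 2 ^ j := one_le_pow₀ (by norm_num)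
  set R : ℝ := 2 ^ j
  have hs : 1 ≤ R ^ δ := Real.one_le_rpow hR hδ
  set s : ℝ := R ^ δ
  have hRm : 0 < R ^ m := by positivity
  set T : ℝ := R ^ m
  set g : Rn n → ℂ := fun x => φ (ρ⁻¹ • (x - y)) * (a x ξ * (starRingEnd ℂ) (a x η)) with hg
  have hφ' : ContDiff ℝ (⊤ : ℕ∞) fun x => φ (ρ⁻¹ • (x - y)) :=
    hφ.comp ((contDiff_const_smul _).comp (contDiff_id.sub contDiff_const))
  have hconj : ContDiff ℝ (⊤ : ℕ∞) fun x => (starRingEnd ℂ) (a x η) :=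
    Complex.conjCLE.contDiff.comp (ha.contDiff_left η)
  have hgd : ∀ k ≤ n + 1, ∀ x, ‖iteratedFDeriv ℝ k g x‖ ≤ (P * T ^ 2) * s ^ k := by
    intro k hk x
    have := norm_iteratedFDeriv_mul_le_two_pow (M := n + 1) (x := x) (s := s) (A := B)
      (B := 2 ^ (n + 1) * ((A * T) * (A * T))) hφ' ((ha.contDiff_left ξ).mul hconj)
      (by positivity) (fun i hi => ?_) (fun i hi => ?_) hk
    · refine this.trans_eq ?_
      rw [hP]
      ring
    · have hρ' : |ρ⁻¹| ≤ 1 := by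
        rw [abs_of_nonneg (by positivity)]
        exact inv_le_one_of_one_le₀ hρ
      exact (hB i hi _ y x hρ').trans (le_mul_of_one_le_right hB0.le (one_le_pow₀ hs))
    · refine norm_iteratedFDeriv_mul_le_two_pow (ha.contDiff_left ξ) hconj (by positivity)
        (fun i hi => ?_) (fun i hi => ?_) hi
      · exact (hA i hi j x ξ h1 h2).trans_eq (by ring)
      · have e := LinearIsometryEquiv.norm_iteratedFDeriv_comp_left Complex.conjLIE
          (fun x => a x η) x i
        exact (e.trans_le (hA i hi j x η h3 h4)).trans_eq (by ring)
  have hgsm : ContDiff ℝ (⊤ : ℕ∞) g := hφ'.mul ((ha.contDiff_left ξ).mul hconj)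
  have hgs : Function.support g ⊆ Metric.closedBall y (2 * ρ) := by
    intro x hx
    have hx' : φ (ρ⁻¹ • (x - y)) ≠ 0 := fun h0 => hx (by simp [hg, h0])
    have := hφs hx'
    rw [mem_closedBall_zero_iff, norm_smul, norm_inv, Real.norm_of_nonneg (by positivity),
      inv_mul_le_iff₀ (by positivity)] at this
    rw [mem_closedBall_iff_norm]
    linarith
  have k0 := hD₀' g y (2 * ρ) (P * T ^ 2) (by positivity) hgsm hgs
    (fun k hk x => by
      obtain rfl : k = 0 := by omega
      simpa using hgd 0 (by omega) x) (ξ - η)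
  have k1 := hD₁' g y (2 * ρ) ((P * T ^ 2) * s ^ (n + 1)) (by positivity) hgsm hgs
    (fun k hk x => (hgd k hk x).trans (by gcongr)) (ξ - η)
  rw [pow_zero, one_mul] at k0
  set J : ℝ := ‖∫ x, Complex.exp (Complex.I * ((⟪ξ - η, x⟫_ℝ : ℝ) : ℂ)) * g x‖
  set b : ℝ := ‖ξ - η‖
  have hb : 0 ≤ b := norm_nonneg _
  have hJ : 0 ≤ J := norm_nonneg _
  rw [← div_eq_mul_inv, le_div_iff₀ (by positivity)]
  calc J * (1 + s⁻¹ * b) ^ (n + 1)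
      ≤ J * (2 ^ n * (1 ^ (n + 1) + (s⁻¹ * b) ^ (n + 1))) := by
        gcongr
        exact add_pow_le zero_le_one (by positivity) (n + 1)
    _ = 2 ^ n * (J + (s ^ (n + 1))⁻¹ * (b ^ (n + 1) * J)) := by
        rw [one_pow, mul_pow, inv_pow]
        ring
    _ ≤ 2 ^ n * (D₀ * (P * T ^ 2 * (2 * ρ) ^ n) +
          (s ^ (n + 1))⁻¹ * (D₁ * (P * T ^ 2 * s ^ (n + 1) * (2 * ρ) ^ n))) := by
        gcongr
    _ = _ := by
        rw [mul_pow]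
        field_simp

end Kernel

section Columns

variable {n : ℕ} {m δ C₀ : ℝ} {a : Rn n → Rn n → ℂ} {ψ : Rn n → ℝ}

/-- Local `L²` bound, uniform in `y`, for the columns `K_j(·,y)` of the dyadic kernels of a symbol
in `S^m_{0,δ}`. -/
theorem exists_setLIntegral_sq_Kj_le (ha : HormClass m 0 δ a) (hδ : 0 ≤ δ) (hC₀ : 1 < C₀)
    (hψ : LPcut C₀ ψ) :
    ∃ C : ℝ, 0 < C ∧ ∀ (j : ℕ) (ρ : ℝ) (y : Rn n), 1 ≤ ρ →
      ∫⁻ x in Metric.closedBall y ρ, ENNReal.ofReal (‖Kj a ψ j x y‖ ^ 2) ≤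
        ENNReal.ofReal (C * (ρ ^ n *
          ((((2 : ℝ) ^ j) ^ m) ^ 2 * (((2 : ℝ) ^ j) ^ n * (((2 : ℝ) ^ j) ^ δ) ^ n)))) := by
  let φ : ContDiffBump (0 : Rn n) := ⟨1, 2, one_pos, one_lt_two⟩
  have hφ : ContDiff ℝ (⊤ : ℕ∞) fun x => (φ x : ℂ) :=
    Complex.ofRealCLM.contDiff.comp φ.contDiff
  have hφs : Function.support (fun x => (φ x : ℂ)) ⊆ Metric.closedBall 0 2 := by
    intro x hx
    have hx' : x ∈ Function.support φ := fun h0 => hx (by simp [h0])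
    rw [φ.support_eq] at hx'
    exact Metric.ball_subset_closedBall hx'
  obtain ⟨D, hD0, hD⟩ := exists_correlation_le ha hδ hC₀ hφ hφs
  obtain ⟨G, hG0, hG⟩ := exists_lintegral_one_add_norm_sub_le n
  set V : ℝ := volume.real (Metric.closedBall (0 : Rn n) 1) with hV
  have hV0 : 0 ≤ V := measureReal_nonneg
  refine ⟨D * G * ((2 * C₀) ^ n * V) + 1, by positivity, ?_⟩
  intro j ρ y hρ
  have hρ0 : 0 < ρ := by linarith
  have hR : (1 : ℝ) ≤ 2 ^ j := one_le_pow₀ (by norm_num)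
  set E : Rn n → Rn n → ℂ := fun x ξ =>
    Complex.exp (Complex.I * ((⟪x - y, ξ⟫_ℝ : ℝ) : ℂ)) * a x ξ *
      ((ψ ((((2 : ℝ) ^ j)⁻¹) • ξ) : ℝ) : ℂ) with hE
  set F : Rn n → ℂ := fun x => ∫ ξ, E x ξ with hF
  set H : Rn n → Rn n × Rn n → ℂ := fun x p =>
    (φ (ρ⁻¹ • (x - y)) : ℂ) * (E x p.1 * (starRingEnd ℂ) (E x p.2)) with hH
  have hEc : Continuous (Function.uncurry E) :=
    (continuous_kernel_integrand ha.1.continuous hψ.1.continuous j).comp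
      (f := fun p : Rn n × Rn n => ((p.1, y), p.2)) (by fun_prop)
  have hEs : ∀ x ξ, ξ ∉ Metric.closedBall (0 : Rn n) (2 * C₀ * 2 ^ j) → E x ξ = 0 := by
    intro x ξ hξ
    have : ψ (((2 : ℝ) ^ j)⁻¹ • ξ) = 0 := by
      by_contra h
      exact hξ (mem_closedBall_zero_iff.2 (hψ.norm_le_of_dilate_ne_zero h))
    simp [hE, this]
  have hφz : ∀ x, x ∉ Metric.closedBall y (2 * ρ) → φ (ρ⁻¹ • (x - y)) = 0 := by
    intro x hx
    by_contra h
    have h2 := hφs (a := ρ⁻¹ • (x - y)) (by simpa using h)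
    rw [mem_closedBall_zero_iff, norm_smul, norm_inv, Real.norm_of_nonneg hρ0.le,
      inv_mul_le_iff₀ hρ0] at h2
    exact hx (mem_closedBall_iff_norm.2 (by linarith))
  have hHc : Continuous (Function.uncurry H) := by
    have e1 : Continuous fun q : Rn n × Rn n × Rn n => E q.1 q.2.1 :=
      hEc.comp (f := fun q : Rn n × Rn n × Rn n => (q.1, q.2.1)) (by fun_prop)
    have e2 : Continuous fun q : Rn n × Rn n × Rn n => E q.1 q.2.2 :=
      hEc.comp (f := fun q : Rn n × Rn n × Rn n => (q.1, q.2.2)) (by fun_prop)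
    have e3 : Continuous fun q : Rn n × Rn n × Rn n => (φ (ρ⁻¹ • (q.1 - y)) : ℂ) :=
      hφ.continuous.comp (f := fun q : Rn n × Rn n × Rn n => ρ⁻¹ • (q.1 - y)) (by fun_prop)
    exact e3.mul (e1.mul (Complex.continuous_conj.comp e2))
  have hHi : Integrable (Function.uncurry H) (volume.prod volume) := by
    refine hHc.integrable_of_hasCompactSupport (HasCompactSupport.intro
      (K := Metric.closedBall y (2 * ρ) ×ˢ (Metric.closedBall (0 : Rn n) (2 * C₀ * 2 ^ j) ×ˢ
        Metric.closedBall (0 : Rn n) (2 * C₀ * 2 ^ j)))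
      ((isCompact_closedBall _ _).prod ((isCompact_closedBall _ _).prod
        (isCompact_closedBall _ _))) ?_)
    rintro ⟨x, ξ, η⟩ hq
    simp only [Set.mem_prod, not_and_or] at hq
    simp only [Function.uncurry, hH]
    rcases hq with h | h | h
    · simp [hφz x h]
    · simp [hEs x ξ h]
    · simp [hEs x η h]
  have hHF : ∀ x, ∫ p, H x p = ((φ (ρ⁻¹ • (x - y)) * ‖F x‖ ^ 2 : ℝ) : ℂ) := by
    intro x
    rw [hH]
    simp only
    rw [integral_const_mul, Measure.volume_eq_prod,
      integral_prod_mul (E x) (fun η => (starRingEnd ℂ) (E x η)), integral_conj, Complex.mul_conj,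
      Complex.normSq_eq_norm_sq]
    push_cast
    rfl
  have hFi : Integrable fun x => φ (ρ⁻¹ • (x - y)) * ‖F x‖ ^ 2 := by
    have h := (hHi.integral_prod_left).norm
    refine h.congr (Filter.Eventually.of_forall fun x => ?_)
    change ‖∫ p, H x p‖ = _
    rw [hHF x, Complex.norm_real, Real.norm_of_nonneg (mul_nonneg φ.nonneg (by positivity))]
  have hcorr : ∀ ξ η : Rn n, ‖∫ x, H x (ξ, η)‖ₑ ≤
      (Metric.closedBall (0 : Rn n) (2 * C₀ * 2 ^ j)).indicator (fun _ =>
        ENNReal.ofReal (D * (ρ ^ n * (((2 : ℝ) ^ j) ^ m) ^ 2)) *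
        ENNReal.ofReal (((1 + (((2 : ℝ) ^ j) ^ δ)⁻¹ * ‖ξ - η‖) ^ (n + 1))⁻¹)) ξ := by
    intro ξ η
    by_cases hξ : ψ (((2 : ℝ) ^ j)⁻¹ • ξ) = 0
    · simp [hH, hE, hξ]
    by_cases hη : ψ (((2 : ℝ) ^ j)⁻¹ • η) = 0
    · simp [hH, hE, hη]
    rw [Set.indicator_of_mem (mem_closedBall_zero_iff.2 (hψ.norm_le_of_dilate_ne_zero hξ)),
      ← ENNReal.ofReal_mul (by positivity), ← ofReal_norm]
    apply ENNReal.ofReal_le_ofReal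
    have e : ∀ x, H x (ξ, η) = (((ψ (((2 : ℝ) ^ j)⁻¹ • ξ) * ψ (((2 : ℝ) ^ j)⁻¹ • η) : ℝ) : ℂ) *
        Complex.exp (((-⟪ξ - η, y⟫_ℝ : ℝ) : ℂ) * Complex.I)) *
        (Complex.exp (Complex.I * ((⟪ξ - η, x⟫_ℝ : ℝ) : ℂ)) *
          ((φ (ρ⁻¹ • (x - y)) : ℂ) * (a x ξ * (starRingEnd ℂ) (a x η)))) := by
      intro x
      have ee : Complex.exp (Complex.I * ((⟪x - y, ξ⟫_ℝ : ℝ) : ℂ)) *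
          (starRingEnd ℂ) (Complex.exp (Complex.I * ((⟪x - y, η⟫_ℝ : ℝ) : ℂ))) =
          Complex.exp (((-⟪ξ - η, y⟫_ℝ : ℝ) : ℂ) * Complex.I) *
            Complex.exp (Complex.I * ((⟪ξ - η, x⟫_ℝ : ℝ) : ℂ)) := by
        rw [← Complex.exp_conj, ← Complex.exp_add, ← Complex.exp_add, map_mul, Complex.conj_I,
          Complex.conj_ofReal]
        congr 1
        simp only [inner_sub_left, inner_sub_right, real_inner_comm x, real_inner_comm y]
        push_cast
        ring
      simp only [hH, hE, map_mul, Complex.conj_ofReal]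
      push_cast at ee ⊢
      linear_combination ((φ (ρ⁻¹ • (x - y)) : ℂ) * a x ξ * (starRingEnd ℂ) (a x η) *
        ψ (((2 : ℝ) ^ j)⁻¹ • ξ) * ψ (((2 : ℝ) ^ j)⁻¹ • η)) * ee
    simp_rw [e]
    rw [integral_const_mul, norm_mul, norm_mul, Complex.norm_exp_ofReal_mul_I, mul_one,
      Complex.norm_real, Real.norm_of_nonneg (mul_nonneg (hψ.2.2.1 _) (hψ.2.2.1 _))]
    refine (mul_le_of_le_one_left (norm_nonneg _)
      (mul_le_one₀ (hψ.2.2.2.1 _) (hψ.2.2.1 _) (hψ.2.2.2.1 _))).trans ?_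
    have a1 := hψ.mem_annulus hξ
    have a2 := hψ.mem_annulus hη
    exact hD j ρ y ξ η hρ a1.1 a1.2 a2.1 a2.2
  have hvol : volume (Metric.closedBall (0 : Rn n) (2 * C₀ * 2 ^ j)) =
      ENNReal.ofReal ((2 * C₀ * 2 ^ j) ^ n * V) := by
    rw [Measure.addHaar_closedBall' _ _ (by positivity), finrank_euclideanSpace,
      Fintype.card_fin, ENNReal.ofReal_mul (by positivity), hV,
      ofReal_measureReal measure_closedBall_lt_top.ne]
  calc ∫⁻ x in Metric.closedBall y ρ, ENNReal.ofReal (‖Kj a ψ j x y‖ ^ 2)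
      ≤ ∫⁻ x in Metric.closedBall y ρ,
          ENNReal.ofReal (φ (ρ⁻¹ • (x - y)) * ‖F x‖ ^ 2) := by
        refine setLIntegral_mono' Metric.isClosed_closedBall.measurableSet fun x hx => ?_
        apply ENNReal.ofReal_le_ofReal
        have h1 : φ (ρ⁻¹ • (x - y)) = 1 := by
          apply φ.one_of_mem_closedBall
          change _ ∈ Metric.closedBall (0 : Rn n) 1
          rw [mem_closedBall_zero_iff, norm_smul, norm_inv, Real.norm_of_nonneg hρ0.le,
            inv_mul_le_iff₀ hρ0, mul_one]
          exact mem_closedBall_iff_norm.1 hx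
        rw [h1, one_mul, Kj, norm_mul]
        gcongr
        exact mul_le_of_le_one_left (norm_nonneg _) (norm_inv_two_pi_pow_le_one n)
    _ ≤ ∫⁻ x, ENNReal.ofReal (φ (ρ⁻¹ • (x - y)) * ‖F x‖ ^ 2) := setLIntegral_le_lintegral _ _
    _ = ENNReal.ofReal (∫ x, φ (ρ⁻¹ • (x - y)) * ‖F x‖ ^ 2) :=
        (ofReal_integral_eq_lintegral_ofReal hFi
          (Filter.Eventually.of_forall fun x => mul_nonneg φ.nonneg (by positivity))).symm
    _ ≤ ‖∫ x, ∫ p, H x p‖ₑ := by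
        simp_rw [hHF]
        rw [integral_complex_ofReal, ← ofReal_norm, Complex.norm_real]
        exact ENNReal.ofReal_le_ofReal (le_abs_self _)
    _ = ‖∫ p, ∫ x, H x p‖ₑ := by rw [integral_integral_swap hHi]
    _ ≤ ∫⁻ p, ‖∫ x, H x p‖ₑ := enorm_integral_le_lintegral_enorm _
    _ ≤ ∫⁻ ξ, ∫⁻ η, ‖∫ x, H x (ξ, η)‖ₑ := lintegral_prod_le _
    _ ≤ ∫⁻ ξ, (Metric.closedBall (0 : Rn n) (2 * C₀ * 2 ^ j)).indicator (fun _ =>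
          ENNReal.ofReal (D * (ρ ^ n * (((2 : ℝ) ^ j) ^ m) ^ 2)) *
            ENNReal.ofReal (G * (((2 : ℝ) ^ j) ^ δ) ^ n)) ξ := by
        refine lintegral_mono fun ξ => (lintegral_mono fun η => hcorr ξ η).trans ?_
        by_cases hξ : ξ ∈ Metric.closedBall (0 : Rn n) (2 * C₀ * 2 ^ j)
        · simp only [Set.indicator_of_mem hξ]
          rw [lintegral_const_mul' _ _ ENNReal.ofReal_ne_top]
          gcongr
          exact hG _ ξ (by positivity)
        · simp [Set.indicator_of_notMem hξ]
    _ = ENNReal.ofReal (D * G * ((2 * C₀) ^ n * V) * (ρ ^ n *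
          ((((2 : ℝ) ^ j) ^ m) ^ 2 * (((2 : ℝ) ^ j) ^ n * (((2 : ℝ) ^ j) ^ δ) ^ n)))) := by
        rw [lintegral_indicator_const Metric.isClosed_closedBall.measurableSet, hvol,
          ← ENNReal.ofReal_mul (by positivity), ← ENNReal.ofReal_mul (by positivity)]
        congr 1
        rw [mul_pow (2 * C₀)]
        ring
    _ ≤ _ := by
        apply ENNReal.ofReal_le_ofReal
        gcongr
        linarith

/-- `L¹` bound for the columns of the dyadic kernels: up to a loss `2 ^ (j θ)`, the operators `T_j`
associated with a symbol in `S^{-n}_{0,δ}` have norm `2 ^ (-j (n / 2) (1 - δ))` on `L¹`. -/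
theorem exists_lintegral_norm_Kj_le (hn : 1 ≤ n) (ha : HormClass (-(n : ℝ)) 0 δ a) (hδ : 0 ≤ δ)
    (hC₀ : 1 < C₀) (hψ : LPcut C₀ ψ) {θ : ℝ} (hθ : 0 < θ) :
    ∃ C : ℝ, 0 < C ∧ ∀ (j : ℕ) (y : Rn n),
      ∫⁻ x, ENNReal.ofReal ‖Kj a ψ j x y‖ ≤
        ENNReal.ofReal (C * ((2 : ℝ) ^ j) ^ (-((n : ℝ) / 2) * (1 - δ) + θ)) := by
  obtain ⟨D, hD0, hD⟩ := exists_setLIntegral_sq_Kj_le ha hδ hC₀ hψ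
  obtain ⟨G, hG0, hG⟩ := exists_lintegral_one_add_norm_sub_le n
  have hn0 : (0 : ℝ) < n := by exact_mod_cast hn
  obtain ⟨L, hL⟩ := exists_nat_ge ((n : ℝ) / 2 * (1 - δ) / (θ / n))
  obtain ⟨A, hA0, hA⟩ := exists_norm_pow_mul_Kj_le ha hC₀ hψ (n + 1 + L)
  set V : ℝ := volume.real (Metric.closedBall (0 : Rn n) 1) with hV
  have hV0 : 0 ≤ V := measureReal_nonneg
  refine ⟨D + V + 2 ^ (n + 1) * A * G, by positivity, fun j y => ?_⟩
  have hR : (1 : ℝ) ≤ 2 ^ j := one_le_pow₀ (by norm_num)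
  set R : ℝ := 2 ^ j
  have hR0 : 0 < R := by positivity
  set ρ : ℝ := R ^ (θ / n) with hρdef
  have hρ : 1 ≤ ρ := Real.one_le_rpow hR (by positivity)
  have hρ0 : 0 < ρ := by linarith
  have hρn : ρ ^ n = R ^ θ := by
    rw [hρdef, ← Real.rpow_mul_natCast hR0.le]
    congr 1
    field_simp
  set s : ℝ := R ^ ((n : ℝ) / 2 * (1 - δ)) with hs
  have hs0 : 0 < s := by positivity
  have htgt : R ^ (-((n : ℝ) / 2) * (1 - δ) + θ) = ρ ^ n * s⁻¹ := by
    rw [hρn, hs, ← Real.rpow_neg hR0.le, ← Real.rpow_add hR0]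
    congr 1
    ring
  have hsq : (R ^ (-(n : ℝ))) ^ 2 * (R ^ n * (R ^ δ) ^ n) = s⁻¹ * s⁻¹ := by
    rw [hs, ← Real.rpow_neg hR0.le, ← Real.rpow_mul_natCast hR0.le,
      ← Real.rpow_mul_natCast hR0.le, ← Real.rpow_natCast R n, ← Real.rpow_add hR0,
      ← Real.rpow_add hR0, ← Real.rpow_add hR0]
    congr 1
    push_cast
    ring
  have hnear : ∫⁻ x in Metric.closedBall y ρ, ENNReal.ofReal ‖Kj a ψ j x y‖ ≤
      ENNReal.ofReal ((D + V) * (ρ ^ n * s⁻¹)) := by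
    calc _ ≤ ∫⁻ x in Metric.closedBall y ρ,
          (ENNReal.ofReal s * ENNReal.ofReal (‖Kj a ψ j x y‖ ^ 2) + ENNReal.ofReal s⁻¹) := by
          refine lintegral_mono fun x => ?_
          rw [← ENNReal.ofReal_mul hs0.le, ← ENNReal.ofReal_add (by positivity) (by positivity)]
          apply ENNReal.ofReal_le_ofReal
          set k := ‖Kj a ψ j x y‖
          have h1 : 0 ≤ s⁻¹ * (s * k - 1) ^ 2 := by positivity
          have h2 : s⁻¹ * (s * k - 1) ^ 2 = s * k ^ 2 - 2 * k + s⁻¹ := by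
            field_simp
            ring
          have h3 : 0 ≤ k := norm_nonneg _
          linarith
      _ = ENNReal.ofReal s * (∫⁻ x in Metric.closedBall y ρ,
            ENNReal.ofReal (‖Kj a ψ j x y‖ ^ 2)) +
            ENNReal.ofReal s⁻¹ * ENNReal.ofReal (ρ ^ n * V) := by
          rw [lintegral_add_right _ measurable_const,
            lintegral_const_mul' _ _ ENNReal.ofReal_ne_top, setLIntegral_const,
            Measure.addHaar_closedBall' _ _ hρ0.le, finrank_euclideanSpace,
            Fintype.card_fin, ENNReal.ofReal_mul (by positivity : 0 ≤ ρ ^ n), hV,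
            ofReal_measureReal measure_closedBall_lt_top.ne]
      _ ≤ ENNReal.ofReal s * ENNReal.ofReal (D * (ρ ^ n * (s⁻¹ * s⁻¹))) +
            ENNReal.ofReal s⁻¹ * ENNReal.ofReal (ρ ^ n * V) := by
          gcongr
          rw [← hsq]
          exact hD j ρ y hρ
      _ = _ := by
          rw [← ENNReal.ofReal_mul (by positivity), ← ENNReal.ofReal_mul (by positivity),
            ← ENNReal.ofReal_add (by positivity) (by positivity)]
          congr 1
          field_simp
  have hfar : ∫⁻ x in (Metric.closedBall y ρ)ᶜ, ENNReal.ofReal ‖Kj a ψ j x y‖ ≤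
      ENNReal.ofReal (2 ^ (n + 1) * A * G * (ρ ^ n * s⁻¹)) := by
    have hsL : s ≤ ρ ^ L := by
      rw [hρdef, hs, ← Real.rpow_mul_natCast hR0.le]
      apply Real.rpow_le_rpow_of_exponent_le hR
      rw [div_le_iff₀ (by positivity)] at hL
      linarith
    calc _ ≤ ∫⁻ x in (Metric.closedBall y ρ)ᶜ, ENNReal.ofReal (2 ^ (n + 1) * A * s⁻¹) *
          ENNReal.ofReal (((1 + 1⁻¹ * ‖y - x‖) ^ (n + 1))⁻¹) := by
          refine setLIntegral_mono' Metric.isClosed_closedBall.measurableSet.compl fun x hx => ?_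
          rw [← ENNReal.ofReal_mul (by positivity)]
          apply ENNReal.ofReal_le_ofReal
          rw [Set.mem_compl_iff, mem_closedBall_iff_norm, not_le] at hx
          rw [inv_one, one_mul, norm_sub_rev y x, ← div_eq_mul_inv, le_div_iff₀ (by positivity)]
          have h1 := hA j x y
          set d := ‖x - y‖
          have hd : 0 < d := by linarith
          set k := ‖Kj a ψ j x y‖
          have hk : 0 ≤ k := norm_nonneg _
          have h2 : (1 + d) ^ (n + 1) ≤ 2 ^ (n + 1) * d ^ (n + 1) := by
            rw [← mul_pow]
            gcongr
            linarith
          have h3 : s ≤ d ^ L := hsL.trans (by gcongr)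
          calc k * (1 + d) ^ (n + 1) ≤ k * (2 ^ (n + 1) * d ^ (n + 1)) := by gcongr
            _ = 2 ^ (n + 1) * (s * (d ^ (n + 1) * k)) * s⁻¹ := by field_simp
            _ ≤ 2 ^ (n + 1) * (d ^ L * (d ^ (n + 1) * k)) * s⁻¹ := by gcongr
            _ = 2 ^ (n + 1) * (d ^ (n + 1 + L) * k) * s⁻¹ := by rw [pow_add d]; ring
            _ ≤ _ := by gcongr
      _ ≤ ∫⁻ x, ENNReal.ofReal (2 ^ (n + 1) * A * s⁻¹) *
          ENNReal.ofReal (((1 + 1⁻¹ * ‖y - x‖) ^ (n + 1))⁻¹) := setLIntegral_le_lintegral _ _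
      _ ≤ ENNReal.ofReal (2 ^ (n + 1) * A * s⁻¹) * ENNReal.ofReal (G * 1 ^ n) := by
          rw [lintegral_const_mul' _ _ ENNReal.ofReal_ne_top]
          gcongr
          exact hG 1 y one_pos
      _ ≤ _ := by
          rw [← ENNReal.ofReal_mul (by positivity)]
          apply ENNReal.ofReal_le_ofReal
          have : 1 ≤ ρ ^ n := one_le_pow₀ hρ
          calc _ = 2 ^ (n + 1) * A * G * (1 * s⁻¹) := by
                rw [one_pow]
                ring
            _ ≤ _ := by gcongr
  rw [htgt, ← lintegral_add_compl _ Metric.isClosed_closedBall.measurableSet, add_mul,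
    ENNReal.ofReal_add (by positivity) (by positivity)]
  exact add_le_add hnear hfar

end Columns

section Cubes

variable {n : ℕ}

theorem cube_eq_preimage (x₀ : Rn n) (l : ℝ) :
    cube x₀ l = (WithLp.ofLp : Rn n → Fin n → ℝ) ⁻¹'
      Set.Icc (fun i => x₀ i - l / 2) (fun i => x₀ i + l / 2) := by
  ext y
  simp only [cube, Set.mem_ofPred_eq, Set.mem_preimage, Set.mem_Icc, Pi.le_def, abs_le,
    ← forall_and]
  refine forall_congr' fun i => ?_
  constructor <;> rintro ⟨h1, h2⟩ <;> constructor <;> linarith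

theorem measurableSet_cube (x₀ : Rn n) (l : ℝ) : MeasurableSet (cube x₀ l) := by
  rw [cube_eq_preimage]
  exact (PiLp.volume_preserving_ofLp (Fin n)).measurable measurableSet_Icc

theorem volume_cube (x₀ : Rn n) {l : ℝ} (hl : 0 ≤ l) :
    volume (cube x₀ l) = ENNReal.ofReal (l ^ n) := by
  rw [cube_eq_preimage, (PiLp.volume_preserving_ofLp (Fin n)).measure_preimage
    measurableSet_Icc.nullMeasurableSet, Real.volume_Icc_pi, ENNReal.ofReal_pow hl]
  simp

theorem setLIntegral_cube_le_mHL {E : Type*} [NormedAddCommGroup E] (u : Rn n → E) (x₀ : Rn n)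
    {l : ℝ} (hl : 0 < l) :
    ∫⁻ y in cube x₀ l, ‖u y‖ₑ ≤ ENNReal.ofReal (l ^ n) * mHL u x₀ := by
  have hx : x₀ ∈ cube x₀ l := fun i => by
    rw [sub_self, abs_zero]
    positivity
  have h : (∫⁻ y in cube x₀ l, ‖u y‖ₑ) / ENNReal.ofReal (l ^ n) ≤ mHL u x₀ :=
    le_iSup_of_le x₀ (le_iSup_of_le l (le_iSup_of_le hl (le_iSup_of_le hx le_rfl)))
  rwa [ENNReal.div_le_iff (by simpa using pow_pos hl n) ENNReal.ofReal_ne_top, mul_comm] at h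

theorem exists_mem_cube_two_pow_mul (x₀ y : Rn n) {s : ℝ} (hs : 0 < s) :
    ∃ k : ℕ, y ∈ cube x₀ (2 ^ k * s) := by
  obtain ⟨k, hk⟩ := pow_unbounded_of_one_lt (2 * ‖y - x₀‖ / s) (one_lt_two (α := ℝ))
  refine ⟨k, fun i => ?_⟩
  rw [div_lt_iff₀ hs] at hk
  have := PiLp.norm_apply_le (y - x₀) i
  rw [PiLp.sub_apply, Real.norm_eq_abs] at this
  linarith

/-- The tail of an integral operator whose kernel decays like `‖x - y‖ ^ (-(n + p))`, `p ≥ 1`, is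
controlled by the maximal function. -/
theorem setLIntegral_compl_cube_le_mHL (u : Rn n → ℂ) (x₀ : Rn n) {p : ℕ} (hp : 1 ≤ p) {l s B : ℝ}
    (hs : 0 < s) (hls : 2 * l ≤ s) (hB : 0 ≤ B) {x : Rn n} (hx : x ∈ cube x₀ l)
    {κ : Rn n → ℝ≥0∞}
    (hκ : ∀ y (d : ℝ), 0 < d → d ≤ ‖x - y‖ → κ y ≤ ENNReal.ofReal (B * (d ^ (n + p))⁻¹)) :
    ∫⁻ y in (cube x₀ s)ᶜ, κ y * ‖u y‖ₑ ≤
      ENNReal.ofReal (B * (4 ^ (n + p) * 2 ^ n) * (s ^ p)⁻¹) * 2 * mHL u x₀ := by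
  set S : ℕ → Set (Rn n) := fun k => cube x₀ (2 ^ (k + 1) * s) \ cube x₀ (2 ^ k * s) with hS
  have hcover : (cube x₀ s)ᶜ ⊆ ⋃ k, S k := by
    intro y hy
    have hex := exists_mem_cube_two_pow_mul x₀ y hs
    classical
    have h0 : Nat.find hex ≠ 0 := by
      intro h
      have := Nat.find_spec hex
      rw [h, pow_zero, one_mul] at this
      exact hy this
    obtain ⟨k, hk⟩ := Nat.exists_eq_succ_of_ne_zero h0
    refine Set.mem_iUnion.2 ⟨k, ?_, Nat.find_min hex (by omega)⟩
    have := Nat.find_spec hex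
    rwa [hk] at this
  have hshell : ∀ k, ∫⁻ y in S k, κ y * ‖u y‖ₑ ≤
      ENNReal.ofReal (B * (4 ^ (n + p) * 2 ^ n) * (s ^ p)⁻¹) * mHL u x₀ * (2⁻¹) ^ k := by
    intro k
    have hd : 0 < 2 ^ k * s / 4 := by positivity
    have h1k : (1 : ℝ) ≤ 2 ^ k := one_le_pow₀ (by norm_num)
    calc ∫⁻ y in S k, κ y * ‖u y‖ₑ
        ≤ ∫⁻ y in S k, ENNReal.ofReal (B * ((2 ^ k * s / 4) ^ (n + p))⁻¹) * ‖u y‖ₑ := by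
          refine setLIntegral_mono' ((measurableSet_cube _ _).diff (measurableSet_cube _ _))
            fun y hy => ?_
          gcongr
          refine hκ y _ hd ?_
          have hy2 : ¬ ∀ i, |y i - x₀ i| ≤ 2 ^ k * s / 2 := hy.2
          push Not at hy2
          obtain ⟨i, hi⟩ := hy2
          have h1 := PiLp.norm_apply_le (x - y) i
          rw [PiLp.sub_apply, Real.norm_eq_abs] at h1
          have h2 := hx i
          have h3 : |y i - x₀ i| ≤ |x i - y i| + |x i - x₀ i| := by
            rw [abs_sub_comm (x i) (y i)]
            exact abs_sub_le _ _ _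
          nlinarith
      _ ≤ ∫⁻ y in cube x₀ (2 ^ (k + 1) * s),
            ENNReal.ofReal (B * ((2 ^ k * s / 4) ^ (n + p))⁻¹) * ‖u y‖ₑ :=
          lintegral_mono_set Set.sdiff_subset
      _ ≤ ENNReal.ofReal (B * ((2 ^ k * s / 4) ^ (n + p))⁻¹) *
            (ENNReal.ofReal ((2 ^ (k + 1) * s) ^ n) * mHL u x₀) := by
          rw [lintegral_const_mul' _ _ ENNReal.ofReal_ne_top]
          gcongr
          exact setLIntegral_cube_le_mHL u x₀ (by positivity)
      _ = ENNReal.ofReal (B * (4 ^ (n + p) * 2 ^ n) * (s ^ p)⁻¹ * ((2 ^ k) ^ p)⁻¹) *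
            mHL u x₀ := by
          rw [← mul_assoc, ← ENNReal.ofReal_mul (by positivity)]
          congr 2
          rw [div_pow, mul_pow, mul_pow, pow_succ, mul_pow, pow_add, pow_add s]
          field_simp
      _ ≤ ENNReal.ofReal (B * (4 ^ (n + p) * 2 ^ n) * (s ^ p)⁻¹ * (2 ^ k)⁻¹) *
            mHL u x₀ := by
          gcongr
          exact le_self_pow₀ h1k (by omega)
      _ = _ := by
          rw [ENNReal.ofReal_mul (by positivity), ENNReal.ofReal_inv_of_pos (by positivity),
            ENNReal.ofReal_pow (by norm_num), ENNReal.ofReal_ofNat, ENNReal.inv_pow]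
          ring
  calc ∫⁻ y in (cube x₀ s)ᶜ, κ y * ‖u y‖ₑ
      ≤ ∫⁻ y in ⋃ k, S k, κ y * ‖u y‖ₑ := lintegral_mono_set hcover
    _ ≤ ∑' k, ∫⁻ y in S k, κ y * ‖u y‖ₑ := lintegral_iUnion_le _ _
    _ ≤ ∑' k, ENNReal.ofReal (B * (4 ^ (n + p) * 2 ^ n) * (s ^ p)⁻¹) * mHL u x₀ * (2⁻¹) ^ k :=
        ENNReal.tsum_le_tsum hshell
    _ = _ := by
        rw [ENNReal.tsum_mul_left, ENNReal.tsum_geometric, ENNReal.one_sub_inv_two, inv_inv]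
        ring

end Cubes

/-- An integral operator whose columns have `L¹` norm at most `A` and whose kernel is
`O(B ‖x - y‖ ^ (-(n + p)))`, `p ≥ 1`, is controlled on averages over `cube x₀ l` by the maximal
function, for any choice of a larger cube `cube x₀ s` separating near and far interactions. -/
theorem setLIntegral_kernel_le_mHL {n : ℕ} {K : Rn n → Rn n → ℂ}
    (hK : Measurable fun q : Rn n × Rn n => K q.1 q.2) {A B : ℝ} (hA : 0 ≤ A) (hB : 0 ≤ B)
    (hcol : ∀ y, ∫⁻ x, ENNReal.ofReal ‖K x y‖ ≤ ENNReal.ofReal A) {p : ℕ} (hp : 1 ≤ p)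
    (hdecay : ∀ x y, ‖x - y‖ ^ (n + p) * ‖K x y‖ ≤ B) {l s : ℝ} (hl : 0 ≤ l) (hs : 0 < s)
    (hls : 2 * l ≤ s) (x₀ : Rn n) {u : Rn n → ℂ} (hu : Measurable u) :
    ∫⁻ x in cube x₀ l, ‖∫ y, K x y * u y‖ₑ ≤
      ENNReal.ofReal (A * s ^ n + B * (4 ^ (n + p) * 2 ^ n) * (s ^ p)⁻¹ * 2 * l ^ n) *
        mHL u x₀ := by
  have hm : Measurable fun q : Rn n × Rn n => ‖K q.1 q.2‖ₑ * ‖u q.2‖ₑ :=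
    hK.enorm.mul (hu.comp measurable_snd).enorm
  have hnear : ∫⁻ x in cube x₀ l, ∫⁻ y in cube x₀ s, ‖K x y‖ₑ * ‖u y‖ₑ ≤
      ENNReal.ofReal (A * s ^ n) * mHL u x₀ := by
    rw [lintegral_lintegral_swap hm.aemeasurable]
    calc _ ≤ ∫⁻ y in cube x₀ s, ENNReal.ofReal A * ‖u y‖ₑ := by
          refine lintegral_mono fun y => ?_
          rw [lintegral_mul_const' _ _ enorm_ne_top]
          gcongr
          refine (setLIntegral_le_lintegral _ _).trans ?_
          simpa only [ofReal_norm] using hcol y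
      _ ≤ ENNReal.ofReal A * (ENNReal.ofReal (s ^ n) * mHL u x₀) := by
          rw [lintegral_const_mul' _ _ ENNReal.ofReal_ne_top]
          gcongr
          exact setLIntegral_cube_le_mHL u x₀ hs
      _ = _ := by rw [← mul_assoc, ← ENNReal.ofReal_mul hA]
  have hfar : ∫⁻ x in cube x₀ l, ∫⁻ y in (cube x₀ s)ᶜ, ‖K x y‖ₑ * ‖u y‖ₑ ≤
      ENNReal.ofReal (B * (4 ^ (n + p) * 2 ^ n) * (s ^ p)⁻¹ * 2 * l ^ n) * mHL u x₀ := by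
    calc _ ≤ ∫⁻ x in cube x₀ l,
          ENNReal.ofReal (B * (4 ^ (n + p) * 2 ^ n) * (s ^ p)⁻¹) * 2 * mHL u x₀ := by
          refine setLIntegral_mono' (measurableSet_cube _ _) fun x hx => ?_
          refine setLIntegral_compl_cube_le_mHL u x₀ hp hs hls hB hx fun y d hd hdxy => ?_
          rw [← ofReal_norm]
          apply ENNReal.ofReal_le_ofReal
          rw [← div_eq_mul_inv, le_div_iff₀ (by positivity), mul_comm]
          refine le_trans ?_ (hdecay x y)
          gcongr
      _ = _ := by
          have e : ENNReal.ofReal (B * (4 ^ (n + p) * 2 ^ n) * (s ^ p)⁻¹ * 2 * l ^ n) =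
              ENNReal.ofReal (B * (4 ^ (n + p) * 2 ^ n) * (s ^ p)⁻¹) * 2 *
                ENNReal.ofReal (l ^ n) := by
            rw [ENNReal.ofReal_mul (by positivity), ENNReal.ofReal_mul (by positivity),
              ENNReal.ofReal_ofNat]
          rw [setLIntegral_const, volume_cube _ hl, e]
          ring
  calc ∫⁻ x in cube x₀ l, ‖∫ y, K x y * u y‖ₑ
      ≤ ∫⁻ x in cube x₀ l, ((∫⁻ y in cube x₀ s, ‖K x y‖ₑ * ‖u y‖ₑ) +
          ∫⁻ y in (cube x₀ s)ᶜ, ‖K x y‖ₑ * ‖u y‖ₑ) := by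
        refine lintegral_mono fun x => ?_
        rw [lintegral_add_compl _ (measurableSet_cube _ _)]
        refine (enorm_integral_le_lintegral_enorm _).trans_eq ?_
        simp_rw [enorm_mul]
    _ = (∫⁻ x in cube x₀ l, ∫⁻ y in cube x₀ s, ‖K x y‖ₑ * ‖u y‖ₑ) +
          ∫⁻ x in cube x₀ l, ∫⁻ y in (cube x₀ s)ᶜ, ‖K x y‖ₑ * ‖u y‖ₑ :=
        lintegral_add_left hm.lintegral_prod_right' _
    _ ≤ _ := by
        rw [ENNReal.ofReal_add (by positivity) (by positivity), add_mul]
        exact add_le_add hnear hfar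

/-- If `a ∈ S^{-n}_{0,δ}` with `0 ≤ δ < 1`, `0 < θ₁ < (n/2)(1-δ)`, `ε > 0`,
and `N > n` is a positive integer, then for `l ≥ 1` and `j ≥ 1`:
`|Q(x₀,l)|⁻¹ ∫_{Q(x₀,l)} |T_j u| dx ≤
  C (2^{-j(n/2)(1-δ)+jθ₁+jεn} + 2^{-jε(N-n)} l^{-(N-n)}) Mu(x₀)`. -/
theorem stmt14 (n : ℕ) (hn : 1 ≤ n) (δ : ℝ) (hδ0 : 0 ≤ δ) (hδ1 : δ < 1)
    (a : Rn n → Rn n → ℂ) (ha : HormClass (-(n : ℝ)) 0 δ a)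
    (θ₁ : ℝ) (hθ₁0 : 0 < θ₁) (hθ₁1 : θ₁ < ((n : ℝ) / 2) * (1 - δ))
    (ε : ℝ) (hε : 0 < ε) (N : ℕ) (hN : n < N)
    (C₀ : ℝ) (hC₀ : 1 < C₀) (ψ : Rn n → ℝ) (hψ : LPcut C₀ ψ) :
    ∃ C : ℝ, 0 < C ∧ ∀ l : ℝ, 1 ≤ l → ∀ j : ℕ, 1 ≤ j →
      ∀ x₀ : Rn n, ∀ u : SchwartzMap (Rn n) ℂ,
        (∫⁻ x in cube x₀ l, (‖Tj a ψ j (⇑u) x‖₊ : ℝ≥0∞)) / ENNReal.ofReal (l ^ n) ≤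
          ENNReal.ofReal (C *
            ((2 : ℝ) ^ (-(j : ℝ) * ((n : ℝ) / 2) * (1 - δ) + (j : ℝ) * θ₁ + (j : ℝ) * ε * n) +
              (2 : ℝ) ^ (-((j : ℝ) * ε) * ((N : ℝ) - n)) * l ^ (-((N : ℝ) - n)))) *
            mHL (⇑u) x₀ := by
  obtain ⟨A, hA0, hA⟩ := exists_lintegral_norm_Kj_le hn ha hδ0 hC₀ hψ hθ₁0
  obtain ⟨p, rfl⟩ : ∃ p, N = n + p := ⟨N - n, by omega⟩
  obtain ⟨B, hB0, hB⟩ := exists_norm_pow_mul_Kj_le ha hC₀ hψ (n + p)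
  refine ⟨A * 2 ^ n + B * (4 ^ (n + p) * 2 ^ n) * 2, by positivity, ?_⟩
  intro l hl j _ x₀ u
  have hl0 : 0 < l := by linarith
  set t : ℝ := (2 : ℝ) ^ ((j : ℝ) * ε) with ht
  have ht1 : 1 ≤ t := Real.one_le_rpow (by norm_num) (by positivity)
  have ht0 : 0 < t := by linarith
  set Q : ℝ := ((2 : ℝ) ^ j) ^ (-((n : ℝ) / 2) * (1 - δ) + θ₁) with hQ
  have hQ0 : 0 < Q := by positivity
  have e1 : (2 : ℝ) ^ (-(j : ℝ) * ((n : ℝ) / 2) * (1 - δ) + (j : ℝ) * θ₁ + (j : ℝ) * ε * n) =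
      Q * t ^ n := by
    rw [hQ, ht, ← Real.rpow_natCast 2 j, ← Real.rpow_mul zero_le_two,
      ← Real.rpow_mul_natCast zero_le_two, ← Real.rpow_add zero_lt_two]
    congr 1
    ring
  have ep : ((n + p : ℕ) : ℝ) - n = p := by
    push_cast
    ring
  have e2 : (2 : ℝ) ^ (-((j : ℝ) * ε) * (((n + p : ℕ) : ℝ) - n)) = (t ^ p)⁻¹ := by
    rw [ep, ht, ← Real.rpow_mul_natCast zero_le_two, ← Real.rpow_neg zero_le_two]
    congr 1
    ring
  have e3 : l ^ (-(((n + p : ℕ) : ℝ) - n)) = (l ^ p)⁻¹ := by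
    rw [ep, Real.rpow_neg hl0.le, Real.rpow_natCast]
  rw [e1, e2, e3]
  have key := setLIntegral_kernel_le_mHL (K := Kj a ψ j)
    (measurable_Kj ha.1.continuous hψ.1.continuous j) (A := A * Q) (by positivity) hB0.le
    (fun y => hA j y) (p := p) (by omega) (fun x y => hB j x y) hl0.le (s := 2 * (t * l))
    (by positivity) (by nlinarith) x₀ u.continuous.measurable
  refine ENNReal.div_le_of_le_mul (key.trans ?_)
  rw [mul_right_comm (ENNReal.ofReal _) (mHL _ _), ← ENNReal.ofReal_mul (by positivity)]
  gcongr
  have hfar : ((2 * (t * l)) ^ p)⁻¹ ≤ (t ^ p)⁻¹ * (l ^ p)⁻¹ := by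
    rw [← mul_inv, ← mul_pow]
    refine inv_anti₀ (by positivity) (pow_le_pow_left₀ (by positivity) ?_ p)
    linarith [mul_pos ht0 hl0]
  calc A * Q * (2 * (t * l)) ^ n +
        B * (4 ^ (n + p) * 2 ^ n) * ((2 * (t * l)) ^ p)⁻¹ * 2 * l ^ n
      ≤ A * Q * (2 * (t * l)) ^ n +
        B * (4 ^ (n + p) * 2 ^ n) * ((t ^ p)⁻¹ * (l ^ p)⁻¹) * 2 * l ^ n := by gcongr
    _ = (A * 2 ^ n * (Q * t ^ n) +
        B * (4 ^ (n + p) * 2 ^ n) * 2 * ((t ^ p)⁻¹ * (l ^ p)⁻¹)) * l ^ n := by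
        rw [mul_pow, mul_pow]
        ring
    _ ≤ _ := by
        gcongr
        have h1 : 0 ≤ A * 2 ^ n * ((t ^ p)⁻¹ * (l ^ p)⁻¹) := by positivity
        have h2 : 0 ≤ B * (4 ^ (n + p) * 2 ^ n) * 2 * (Q * t ^ n) := by positivity
        linarith
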